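/- arXiv:2508.12374 — 8 statements merged into one kernel-verified Lean document; each statement's English description precedes it below -/
import Mathlib

section
/- Let X be a compact Hausdorff space, x_0 a point of X, and P a primal ideal of the TRO V. Then I_{x_0,P} := {f ∈ C(X,V) : f(x_0) ∈ P} is a primal ideal of C(X,V). -/
noncomputable section

open ContinuousLinearMap

variable {H K : Type*} [NormedAddCommGroup H] [InnerProductSpace ℂ H] [CompleteSpace H]
  [NormedAddCommGroup K] [InnerProductSpace ℂ K] [CompleteSpace K]

/-- The ternary product `x y* z` on `B(H,K)`. -/
def tri (x y z : H →L[ℂ] K) : H →L[ℂ] K :=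
  x ∘L (ContinuousLinearMap.adjoint y ∘L z)

/-- The pointwise ternary product on continuous `B(H,K)`-valued maps. -/
def ctri {X : Type*} [TopologicalSpace X] (f g h : C(X, H →L[ℂ] K)) : C(X, H →L[ℂ] K) :=
  ⟨fun x => tri (f x) (g x) (h x),
    f.continuous.clm_comp
      (((ContinuousLinearMap.adjoint :
          (H →L[ℂ] K) ≃ₗᵢ⋆[ℂ] (K →L[ℂ] H)).continuous.comp g.continuous).clm_comp
        h.continuous)⟩

/-- `C(X,V)`: continuous maps `X → B(H,K)` taking values in `V`, as a subset of
`C(X, B(H,K))`. -/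
def CXV (X : Type*) [TopologicalSpace X] (V : Set (H →L[ℂ] K)) : Set C(X, H →L[ℂ] K) :=
  {f | ∀ x, f x ∈ V}

section Ideals

variable {E : Type*} [AddCommGroup E] [Module ℂ E] [TopologicalSpace E]

/-- `I` is a (closed) ideal of the TRO-like set `V`, with respect to the ternary
product `t`. -/
structure IsIdealT (t : E → E → E → E) (V I : Set E) : Prop where
  subset : I ⊆ V
  isClosed : IsClosed I
  zero_mem : (0 : E) ∈ I
  add_mem : ∀ a b, a ∈ I → b ∈ I → a + b ∈ I
  smul_mem : ∀ (c : ℂ), ∀ a, a ∈ I → c • a ∈ I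
  tri_mem_left : ∀ a b c, a ∈ I → b ∈ V → c ∈ V → t a b c ∈ I
  tri_mem_right : ∀ a b c, a ∈ V → b ∈ V → c ∈ I → t a b c ∈ I

/-- The odd product `j₁ j₂* j₃ ⋯ j₂ₙ* j₂ₙ₊₁` of a `(2n+1)`-tuple, with respect to the
ternary product `t`. -/
def oddProdT (t : E → E → E → E) : (n : ℕ) → (Fin (2 * n + 1) → E) → E
  | 0, j => j 0
  | n + 1, j =>
      t (oddProdT t n fun i => j (Fin.castLE (by omega) i))
        (j ⟨2 * n + 1, by omega⟩) (j ⟨2 * n + 2, by omega⟩)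

/-- `P` is a primal ideal of `V` with respect to the ternary product `t`. -/
def IsPrimalT (t : E → E → E → E) (V P : Set E) : Prop :=
  IsIdealT t V P ∧
    ∀ n : ℕ, 1 ≤ n → ∀ J : Fin (2 * n + 1) → Set E, (∀ i, IsIdealT t V (J i)) →
      (∀ j : Fin (2 * n + 1) → E, (∀ i, j i ∈ J i) → oddProdT t n j = 0) →
      ∃ k, J k ⊆ P

end Ideals

theorem tri_continuous {Y : Type*} [TopologicalSpace Y] {f g h : Y → (H →L[ℂ] K)}
    (hf : Continuous f) (hg : Continuous g) (hh : Continuous h) :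
    Continuous fun y => tri (f y) (g y) (h y) :=
  hf.clm_comp
    (((ContinuousLinearMap.adjoint :
        (H →L[ℂ] K) ≃ₗᵢ⋆[ℂ] (K →L[ℂ] H)).continuous.comp hg).clm_comp hh)

theorem oddProdT_continuous (n : ℕ) :
    Continuous fun j : Fin (2 * n + 1) → (H →L[ℂ] K) => oddProdT tri n j := by
  induction n with
  | zero => exact continuous_apply _
  | succ n ih =>
    have h1 : Continuous fun j : Fin (2 * (n + 1) + 1) → (H →L[ℂ] K) =>
        oddProdT tri n (fun i => j (Fin.castLE (by omega) i)) :=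
      ih.comp (continuous_pi fun i => continuous_apply _)
    exact tri_continuous h1 (continuous_apply _) (continuous_apply _)

theorem oddProdT_eval {X : Type*} [TopologicalSpace X] (x : X) (n : ℕ)
    (j : Fin (2 * n + 1) → C(X, H →L[ℂ] K)) :
    (oddProdT ctri n j) x = oddProdT tri n (fun i => j i x) := by
  induction n with
  | zero => rfl
  | succ n ih =>
    have := ih (fun i => j (Fin.castLE (by omega) i))
    simp only [oddProdT]
    rw [← this]
    rfl

theorem closure_ideal_aux (V : Set (H →L[ℂ] K)) (hVc : IsClosed V) (S : Set (H →L[ℂ] K))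
    (h1 : S ⊆ V) (h2 : (0 : H →L[ℂ] K) ∈ S)
    (h3 : ∀ a ∈ S, ∀ b ∈ S, a + b ∈ S) (h4 : ∀ (c : ℂ), ∀ a ∈ S, c • a ∈ S)
    (h5 : ∀ b ∈ V, ∀ c ∈ V, ∀ a ∈ S, tri a b c ∈ S)
    (h6 : ∀ a ∈ V, ∀ b ∈ V, ∀ c ∈ S, tri a b c ∈ S) :
    IsIdealT tri V (closure S) := by
  refine ⟨closure_minimal h1 hVc, isClosed_closure, subset_closure h2, ?_, ?_, ?_, ?_⟩
  · intro a b ha hb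
    exact map_mem_closure₂ continuous_add ha hb h3
  · intro c a ha
    exact map_mem_closure (continuous_const_smul c) ha (h4 c)
  · intro a b c ha hb hc
    have hcont : Continuous fun a : H →L[ℂ] K => tri a b c :=
      tri_continuous continuous_id continuous_const continuous_const
    exact map_mem_closure (f := fun a => tri a b c) hcont ha (h5 b hb c hc)
  · intro a b c ha hb hc
    have hcont : Continuous fun c : H →L[ℂ] K => tri a b c :=
      tri_continuous continuous_const continuous_const continuous_id
    exact map_mem_closure hcont hc (h6 a ha b hb)

theorem closure_eval_ideal {X : Type*} [TopologicalSpace X] (x₀ : X)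
    (V : Set (H →L[ℂ] K)) (hV : IsIdealT (tri (H := H) (K := K)) V V)
    (J : Set C(X, H →L[ℂ] K)) (hJ : IsIdealT ctri (CXV X V) J) :
    IsIdealT tri V (closure ((fun f : C(X, H →L[ℂ] K) => f x₀) '' J)) := by
  apply closure_ideal_aux V hV.isClosed
  · rintro _ ⟨f, hf, rfl⟩
    exact hJ.subset hf x₀
  · exact ⟨0, hJ.zero_mem, rfl⟩
  · rintro _ ⟨f, hf, rfl⟩ _ ⟨g, hg, rfl⟩
    exact ⟨f + g, hJ.add_mem _ _ hf hg, rfl⟩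
  · rintro c _ ⟨f, hf, rfl⟩
    exact ⟨c • f, hJ.smul_mem _ _ hf, rfl⟩
  · rintro b hb c hc _ ⟨f, hf, rfl⟩
    exact ⟨ctri f (ContinuousMap.const X b) (ContinuousMap.const X c),
      hJ.tri_mem_left _ _ _ hf (fun _ => hb) (fun _ => hc), rfl⟩
  · rintro a ha b hb _ ⟨f, hf, rfl⟩
    exact ⟨ctri (ContinuousMap.const X a) (ContinuousMap.const X b) f,
      hJ.tri_mem_right _ _ _ (fun _ => ha) (fun _ => hb) hf, rfl⟩

/-- If `X` is a compact Hausdorff space, `x₀ ∈ X` and `P` is a primal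
ideal of the TRO `V`, then `I_{x₀,P} = {f ∈ C(X,V) : f x₀ ∈ P}` is a primal ideal of
`C(X,V)`. -/
theorem primal_eval_ideal_of_primal
    {X : Type*} [TopologicalSpace X] [CompactSpace X] [T2Space X] (x₀ : X)
    (V : Set (H →L[ℂ] K)) (hV : IsIdealT (tri (H := H) (K := K)) V V)
    (P : Set (H →L[ℂ] K)) (hP : IsPrimalT tri V P) :
    IsPrimalT (ctri (X := X)) (CXV X V)
      {f : C(X, H →L[ℂ] K) | f ∈ CXV X V ∧ f x₀ ∈ P} := by
  obtain ⟨hPI, hPp⟩ := hP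
  refine ⟨?_, ?_⟩
  · refine ⟨fun f hf => hf.1, ?_, ?_, ?_, ?_, ?_, ?_⟩
    · have h1 : IsClosed {f : C(X, H →L[ℂ] K) | ∀ x, f x ∈ V} := by
        rw [Set.ofPred_forall]
        exact isClosed_iInter fun x => hV.isClosed.preimage (continuous_eval_const x)
      have h2 : IsClosed {f : C(X, H →L[ℂ] K) | f x₀ ∈ P} :=
        hPI.isClosed.preimage (continuous_eval_const x₀)
      exact h1.inter h2
    · exact ⟨fun _ => hV.zero_mem, hPI.zero_mem⟩
    · exact fun a b ha hb =>
        ⟨fun x => hV.add_mem _ _ (ha.1 x) (hb.1 x), hPI.add_mem _ _ ha.2 hb.2⟩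
    · exact fun c a ha => ⟨fun x => hV.smul_mem _ _ (ha.1 x), hPI.smul_mem _ _ ha.2⟩
    · exact fun a b c ha hb hc => ⟨fun x => hV.tri_mem_left _ _ _ (ha.1 x) (hb x) (hc x),
        hPI.tri_mem_left _ _ _ ha.2 (hb x₀) (hc x₀)⟩
    · exact fun a b c ha hb hc => ⟨fun x => hV.tri_mem_left _ _ _ (ha x) (hb x) (hc.1 x),
        hPI.tri_mem_right _ _ _ (ha x₀) (hb x₀) hc.2⟩
  · intro n hn J hJ h0
    obtain ⟨k, hk⟩ := hPp n hn
      (fun i => closure ((fun f : C(X, H →L[ℂ] K) => f x₀) '' J i))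
      (fun i => closure_eval_ideal x₀ V hV (J i) (hJ i)) (by
        intro j hj
        have hmem : j ∈ closure (Set.pi Set.univ
            fun i => (fun f : C(X, H →L[ℂ] K) => f x₀) '' J i) := by
          rw [closure_pi_set]
          exact fun i _ => hj i
        have hcl : IsClosed {j : Fin (2 * n + 1) → (H →L[ℂ] K) | oddProdT tri n j = 0} :=
          isClosed_eq (oddProdT_continuous n) continuous_const
        refine closure_minimal ?_ hcl hmem
        intro j' hj'
        choose f hf hfe using fun i => hj' i (Set.mem_univ i)
        have he : (fun i => f i x₀) = j' := funext hfe
        show oddProdT tri n j' = 0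
        rw [← he, ← oddProdT_eval, h0 f hf]
        rfl)
    exact ⟨k, fun f hf => ⟨(hJ k).subset hf, hk (subset_closure ⟨f, hf, rfl⟩)⟩⟩
end
end

section
/- Let A be a C*-algebra, X a compact Hausdorff space, x_0 a point of X, and P a primal ideal of A. Then I_{x_0,P} := {f ∈ C(X,A) : f(x_0) ∈ P} is a primal ideal of C(X,A). -/
noncomputable section

/-- The product `a 0 * a 1 * ⋯ * a n` of a nonempty tuple (grouped to the left). -/
def finProd {R : Type*} [Mul R] : (n : ℕ) → (Fin (n + 1) → R) → R
  | 0, a => a 0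
  | n + 1, a => finProd n (fun i => a i.castSucc) * a (Fin.last (n + 1))

section Ideals

variable {R : Type*} [NonUnitalRing R] [TopologicalSpace R]

/-- `I` is a norm-closed two-sided ideal of `R`. -/
structure IsClosedIdealR (I : Set R) : Prop where
  isClosed : IsClosed I
  zero_mem : (0 : R) ∈ I
  add_mem : ∀ a b, a ∈ I → b ∈ I → a + b ∈ I
  neg_mem : ∀ a, a ∈ I → -a ∈ I
  mul_mem_left : ∀ a b, b ∈ I → a * b ∈ I
  mul_mem_right : ∀ a b, a ∈ I → a * b ∈ I

/-- `P` is a primal ideal of `R`: for every `n ≥ 1` and all closed two-sided ideals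
`J 0, …, J (n-1)` of `R` such that `a 0 * ⋯ * a (n-1) = 0` for all choices
`a i ∈ J i`, some `J k` is contained in `P`. -/
def IsPrimalR (P : Set R) : Prop :=
  IsClosedIdealR P ∧
    ∀ (n : ℕ) (J : Fin (n + 1) → Set R), (∀ i, IsClosedIdealR (J i)) →
      (∀ a : Fin (n + 1) → R, (∀ i, a i ∈ J i) → finProd n a = 0) →
      ∃ k, J k ⊆ P

end Ideals

theorem finProd_continuous_aux {R : Type*} [Mul R] [TopologicalSpace R] [ContinuousMul R] :
    ∀ n : ℕ, Continuous (fun a : Fin (n + 1) → R => finProd n a)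
  | 0 => by
    simp only [finProd]
    exact continuous_apply 0
  | n + 1 => by
    simp only [finProd]
    exact ((finProd_continuous_aux n).comp
      (continuous_pi fun i => continuous_apply (Fin.castSucc i))).mul
      (continuous_apply (Fin.last (n + 1)))

theorem finProd_eval_aux {A X : Type*} [NonUnitalRing A] [TopologicalSpace A]
    [IsTopologicalRing A] [TopologicalSpace X] (x : X) :
    ∀ (n : ℕ) (f : Fin (n + 1) → C(X, A)), (finProd n f) x = finProd n (fun i => f i x)
  | 0, f => rfl
  | n + 1, f => by
    simp only [finProd, ContinuousMap.mul_apply]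
    rw [finProd_eval_aux x n]

theorem closure_eval_aux {A X : Type*} [NonUnitalRing A] [TopologicalSpace A]
    [IsTopologicalRing A] [TopologicalSpace X] (x : X) (J : Set C(X, A))
    (hJ : IsClosedIdealR J) : IsClosedIdealR (closure ((fun f : C(X, A) => f x) '' J)) where
  isClosed := isClosed_closure
  zero_mem := subset_closure ⟨0, hJ.zero_mem, rfl⟩
  add_mem a b ha hb := by
    refine map_mem_closure₂ continuous_add ha hb ?_
    rintro _ ⟨f, hf, rfl⟩ _ ⟨g, hg, rfl⟩
    exact ⟨f + g, hJ.add_mem _ _ hf hg, rfl⟩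
  neg_mem a ha := by
    refine map_mem_closure continuous_neg ha ?_
    rintro _ ⟨f, hf, rfl⟩
    exact ⟨-f, hJ.neg_mem _ hf, rfl⟩
  mul_mem_left a b hb := by
    refine map_mem_closure (continuous_const_mul a) hb ?_
    rintro _ ⟨f, hf, rfl⟩
    exact ⟨ContinuousMap.const X a * f, hJ.mul_mem_left _ _ hf, rfl⟩
  mul_mem_right a b ha := by
    refine map_mem_closure (f := fun y => y * b) (continuous_mul_const b) ha ?_
    rintro _ ⟨f, hf, rfl⟩
    exact ⟨f * ContinuousMap.const X b, hJ.mul_mem_right _ _ hf, rfl⟩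

/-- If `A` is a C*-algebra, `X` a compact Hausdorff space, `x₀ ∈ X`
and `P` a primal ideal of `A`, then `I_{x₀,P} = {f ∈ C(X,A) : f x₀ ∈ P}` is a primal
ideal of `C(X,A)`. -/
theorem primal_eval_ideal_of_primal_cstar
    {A : Type*} [NonUnitalCStarAlgebra A]
    {X : Type*} [TopologicalSpace X] [CompactSpace X] [T2Space X] (x₀ : X)
    (P : Set A) (hP : IsPrimalR P) :
    IsPrimalR {f : C(X, A) | f x₀ ∈ P} := by
  obtain ⟨hI, hprim⟩ := hP
  refine ⟨⟨hI.isClosed.preimage (continuous_eval_const x₀), hI.zero_mem,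
    fun a b ha hb => hI.add_mem _ _ ha hb, fun a ha => hI.neg_mem _ ha,
    fun a b hb => hI.mul_mem_left _ _ hb, fun a b ha => hI.mul_mem_right _ _ ha⟩, ?_⟩
  intro n J hJ h0
  obtain ⟨k, hk⟩ := hprim n (fun i => closure ((fun f : C(X, A) => f x₀) '' J i))
    (fun i => closure_eval_aux x₀ (J i) (hJ i)) (by
      intro a ha
      have hmem : a ∈ closure (Set.pi Set.univ
          (fun i => (fun f : C(X, A) => f x₀) '' J i)) := by
        rw [closure_pi_set]
        exact fun i _ => ha i
      have hcl : IsClosed {a : Fin (n + 1) → A | finProd n a = 0} :=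
        isClosed_eq (finProd_continuous_aux n) continuous_const
      refine closure_minimal ?_ hcl hmem
      intro b hb
      choose f hf hfb using fun i => hb i (Set.mem_univ i)
      have hb' : b = fun i => f i x₀ := funext fun i => (hfb i).symm
      change finProd n b = 0
      rw [hb', ← finProd_eval_aux, h0 f hf]
      rfl)
  exact ⟨k, fun f hf => hk (subset_closure ⟨f, hf, rfl⟩)⟩
end
end

section
/- Let A be a C*-algebra, X a compact Hausdorff space, x_0 a point of X, and P an ideal of A. If I_{x_0,P} := {f ∈ C(X,A) : f(x_0) ∈ P} is a primal ideal of C(X,A), then P is a primal ideal of A. -/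
noncomputable section

theorem finProd_apply_aux {A X : Type*} [NonUnitalCStarAlgebra A] [TopologicalSpace X] (x : X) :
    ∀ (n : ℕ) (a : Fin (n + 1) → C(X, A)), finProd n a x = finProd n (fun i => a i x)
  | 0, a => rfl
  | n + 1, a => by
    simp only [finProd, ContinuousMap.mul_apply]
    rw [finProd_apply_aux x n]

/-- If `A` is a C*-algebra, `X` a compact Hausdorff space, `x₀ ∈ X`,
`P` an ideal of `A`, and `I_{x₀,P} = {f ∈ C(X,A) : f x₀ ∈ P}` is a primal ideal of
`C(X,A)`, then `P` is a primal ideal of `A`. -/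
theorem primal_of_primal_eval_ideal_cstar
    {A : Type*} [NonUnitalCStarAlgebra A]
    {X : Type*} [TopologicalSpace X] [CompactSpace X] [T2Space X] (x₀ : X)
    (P : Set A) (hP : IsClosedIdealR P)
    (hprimal : IsPrimalR {f : C(X, A) | f x₀ ∈ P}) :
    IsPrimalR P := by
  refine ⟨hP, fun n J hJ hz => ?_⟩
  have h1 : ∀ i, IsClosedIdealR {f : C(X, A) | ∀ x, f x ∈ J i} := by
    intro i
    refine ⟨?_, fun _ => (hJ i).zero_mem, fun a b ha hb x => (hJ i).add_mem _ _ (ha x) (hb x),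
      fun a ha x => (hJ i).neg_mem _ (ha x), fun a b hb x => (hJ i).mul_mem_left _ _ (hb x),
      fun a b ha x => (hJ i).mul_mem_right _ _ (ha x)⟩
    simp only [Set.ofPred_forall]
    exact isClosed_iInter fun x => (hJ i).isClosed.preimage (continuous_eval_const (F := C(X, A)) x)
  have h2 : ∀ a : Fin (n + 1) → C(X, A), (∀ i, a i ∈ {f : C(X, A) | ∀ x, f x ∈ J i}) →
      finProd n a = 0 := by
    intro a ha
    ext x
    rw [finProd_apply_aux]
    exact hz _ fun i => ha i x
  obtain ⟨k, hk⟩ := hprimal.2 n (fun i => {f : C(X, A) | ∀ x, f x ∈ J i}) h1 h2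
  refine ⟨k, fun a ha => ?_⟩
  exact hk (show ContinuousMap.const X a ∈ {f : C(X, A) | ∀ x, f x ∈ J k} from fun _ => ha)
end
end

section
/- Let X be a compact Hausdorff space and let I be a primal ideal of C(X,V). Then there exist a point x_0 ∈ X and a primal ideal P of V such that I = I_{x_0,P} := {f ∈ C(X,V) : f(x_0) ∈ P}. -/
noncomputable section

open ContinuousLinearMap

variable {H K : Type*} [NormedAddCommGroup H] [InnerProductSpace ℂ H] [CompleteSpace H]
  [NormedAddCommGroup K] [InnerProductSpace ℂ K] [CompleteSpace K]

section Helpers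

variable {X : Type*} [TopologicalSpace X]

lemma tri_zero_left' (b c : H →L[ℂ] K) : tri 0 b c = 0 := by simp [tri]

lemma tri_zero_mid' (b c : H →L[ℂ] K) : tri b 0 c = 0 := by simp [tri]

lemma tri_zero_right' (b c : H →L[ℂ] K) : tri b c 0 = 0 := by simp [tri]

lemma ctri_apply' (f g h : C(X, H →L[ℂ] K)) (x : X) :
    ctri f g h x = tri (f x) (g x) (h x) := rfl

lemma oddProd_apply' (x : X) (n : ℕ) (j : Fin (2 * n + 1) → C(X, H →L[ℂ] K)) :
    oddProdT ctri n j x = oddProdT tri n (fun i => j i x) := by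
  induction n with
  | zero => rfl
  | succ n ih =>
    simp only [oddProdT, ctri_apply', ih]

lemma isClosed_CXV' {J : Set (H →L[ℂ] K)} (hJ : IsClosed J) : IsClosed (CXV X J) := by
  have : CXV X J = ⋂ x : X, (fun f : C(X, H →L[ℂ] K) => f x) ⁻¹' J := by
    ext f; simp [CXV]
  rw [this]
  exact isClosed_iInter fun x => hJ.preimage (continuous_eval_const x)

lemma isIdeal_CXV' {V J : Set (H →L[ℂ] K)} (hJ : IsIdealT tri V J) :
    IsIdealT (ctri (X := X)) (CXV X V) (CXV X J) where
  subset f hf x := hJ.subset (hf x)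
  isClosed := isClosed_CXV' hJ.isClosed
  zero_mem x := hJ.zero_mem
  add_mem a b ha hb x := hJ.add_mem _ _ (ha x) (hb x)
  smul_mem c a ha x := hJ.smul_mem c _ (ha x)
  tri_mem_left a b c ha hb hc x := hJ.tri_mem_left _ _ _ (ha x) (hb x) (hc x)
  tri_mem_right a b c ha hb hc x := hJ.tri_mem_right _ _ _ (ha x) (hb x) (hc x)

/-- Maps in `C(X,V)` vanishing off `U`. -/
def vanOff (V : Set (H →L[ℂ] K)) (U : Set X) : Set C(X, H →L[ℂ] K) :=
  {f | f ∈ CXV X V ∧ ∀ x, x ∉ U → f x = 0}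

lemma isIdeal_vanOff {V : Set (H →L[ℂ] K)} (hV : IsIdealT tri V V) (U : Set X) :
    IsIdealT (ctri (X := X)) (CXV X V) (vanOff V U) where
  subset f hf := hf.1
  isClosed := by
    have : vanOff V U = CXV X V ∩
        ⋂ x : X, ⋂ _ : x ∉ U, (fun f : C(X, H →L[ℂ] K) => f x) ⁻¹' {0} := by
      ext f; simp [vanOff]
    rw [this]
    exact (isClosed_CXV' hV.isClosed).inter (isClosed_iInter fun x => isClosed_iInter fun _ =>
      isClosed_singleton.preimage (continuous_eval_const x))
  zero_mem := ⟨fun _ => hV.zero_mem, fun _ _ => rfl⟩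
  add_mem a b ha hb := ⟨fun x => hV.add_mem _ _ (ha.1 x) (hb.1 x), fun x hx => by
    simp [ha.2 x hx, hb.2 x hx]⟩
  smul_mem c a ha := ⟨fun x => hV.smul_mem c _ (ha.1 x), fun x hx => by
    simp [ha.2 x hx]⟩
  tri_mem_left a b c ha hb hc :=
    ⟨fun x => hV.tri_mem_left _ _ _ (ha.1 x) (hb x) (hc x), fun x hx => by
      rw [ctri_apply', ha.2 x hx, tri_zero_left']⟩
  tri_mem_right a b c ha hb hc :=
    ⟨fun x => hV.tri_mem_right _ _ _ (ha x) (hb x) (hc.1 x), fun x hx => by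
      rw [ctri_apply', hc.2 x hx, tri_zero_right']⟩

/-- Multiply a map by a real function. -/
def rmul (p : C(X, ℝ)) (f : C(X, H →L[ℂ] K)) : C(X, H →L[ℂ] K) :=
  ⟨fun x => ((p x : ℝ) : ℂ) • f x,
    (Complex.continuous_ofReal.comp p.continuous).smul f.continuous⟩

lemma rmul_mem {V : Set (H →L[ℂ] K)} (hV : IsIdealT tri V V) (p : C(X, ℝ))
    {f : C(X, H →L[ℂ] K)} (hf : f ∈ CXV X V) : rmul p f ∈ CXV X V :=
  fun x => hV.smul_mem _ _ (hf x)

lemma disj_primal {V : Set (H →L[ℂ] K)} (hV : IsIdealT tri V V)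
    {I : Set C(X, H →L[ℂ] K)} (hI : IsPrimalT (ctri (X := X)) (CXV X V) I)
    {U W : Set X} (h : Disjoint U W) : vanOff V U ⊆ I ∨ vanOff V W ⊆ I := by
  obtain ⟨k, hk⟩ := hI.2 1 le_rfl (fun i => if i = 0 then vanOff V U else vanOff V W)
    (fun i => by
      change IsIdealT ctri (CXV X V) (if i = 0 then vanOff V U else vanOff V W)
      split_ifs
      · exact isIdeal_vanOff hV U
      · exact isIdeal_vanOff hV W)
    (fun j hj => by
      have h0 : j 0 ∈ vanOff V U := by simpa using hj 0
      have h1 : j 1 ∈ vanOff V W := by simpa using hj 1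
      ext1 x
      change tri (j 0 x) (j 1 x) (j 2 x) = 0
      by_cases hx : x ∈ U
      · rw [h1.2 x (Set.disjoint_left.1 h hx), tri_zero_mid']
      · rw [h0.2 x hx, tri_zero_left'])
  by_cases h0 : k = 0
  · left; simpa [h0] using hk
  · right; simpa [h0] using hk

lemma sum_mem' {E : Type*} [AddCommGroup E] [Module ℂ E] [TopologicalSpace E]
    {t : E → E → E → E} {V I : Set E} (hI : IsIdealT t V I) {ι : Type*} (s : Finset ι)
    (g : ι → E) (hg : ∀ i ∈ s, g i ∈ I) : ∑ i ∈ s, g i ∈ I :=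
  Finset.sum_induction g (· ∈ I) (fun a b => hI.add_mem a b) hI.zero_mem hg

lemma exists_point [CompactSpace X] [T2Space X] [Nonempty X]
    {V : Set (H →L[ℂ] K)} (hV : IsIdealT tri V V)
    {I : Set C(X, H →L[ℂ] K)} (hI : IsPrimalT (ctri (X := X)) (CXV X V) I) :
    ∃ x₀ : X, ∀ f ∈ CXV X V, f x₀ = 0 → f ∈ I := by
  by_cases hall : ∀ x : X, ∃ U : Set X, IsOpen U ∧ x ∈ U ∧ vanOff V U ⊆ I
  · refine ⟨Classical.arbitrary X, fun f hf _ => ?_⟩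
    choose U hU hxU hUI using hall
    obtain ⟨t, ht⟩ := isCompact_univ.elim_finite_subcover U hU
      (fun x _ => Set.mem_iUnion.2 ⟨x, hxU x⟩)
    obtain ⟨p, hp⟩ := PartitionOfUnity.exists_isSubordinate (s := (Set.univ : Set X))
      isClosed_univ (fun i : t => U i) (fun i => hU i) (by
        intro x hx
        have := ht hx
        simp only [Set.mem_iUnion] at this ⊢
        obtain ⟨i, hi, hx⟩ := this
        exact ⟨⟨i, hi⟩, hx⟩)
    have hsum : f = ∑ i : t, rmul (p i) f := by
      ext1 x
      have h1 := p.sum_eq_one (Set.mem_univ x)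
      rw [finsum_eq_sum_of_fintype] at h1
      rw [ContinuousMap.sum_apply]
      change f x = ∑ i : t, ((p i x : ℝ) : ℂ) • f x
      rw [← Finset.sum_smul, ← Complex.ofReal_sum, h1]
      simp
    rw [hsum]
    refine sum_mem' hI.1 _ _ fun i _ => hUI i ⟨rmul_mem hV _ hf, fun x hx => ?_⟩
    have : p i x = 0 := by
      by_contra h
      exact hx (hp i (subset_tsupport _ h))
    change ((p i x : ℝ) : ℂ) • f x = 0
    simp [this]
  · push Not at hall
    obtain ⟨x₀, hx₀⟩ := hall
    refine ⟨x₀, fun f hf hf0 => ?_⟩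
    rw [← hI.1.isClosed.closure_eq]
    refine (Metric.mem_closure_iff (α := C(X, H →L[ℂ] K))).2 ?_
    intro ε hε
    set p : C(X, ℝ) := ⟨fun x => max 0 (min 1 (4 * ‖f x‖ / ε - 1)), by fun_prop⟩
    have hpx : ∀ x, p x = max 0 (min 1 (4 * ‖f x‖ / ε - 1)) := fun x => rfl
    refine ⟨rmul p f, ?_, ?_⟩
    · have hdisj : Disjoint {x : X | ‖f x‖ < ε / 4} {x | ε / 4 ≤ ‖f x‖} := by
        rw [Set.disjoint_left]
        intro x hx hx'
        exact (not_lt.2 (show ε / 4 ≤ ‖f x‖ from hx')) hx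
      rcases disj_primal hV hI hdisj with h | h
      · exact absurd h (hx₀ _ (isOpen_lt (by fun_prop) continuous_const) (by
          simp [hf0, hε]))
      · refine h ⟨rmul_mem hV _ hf, fun x hx => ?_⟩
        have hx : ‖f x‖ < ε / 4 := not_le.1 hx
        have : p x = 0 := by
          rw [hpx]
          apply max_eq_left
          apply (min_le_right _ _).trans
          rw [sub_nonpos, div_le_one hε]
          linarith
        change ((p x : ℝ) : ℂ) • f x = 0
        simp [this]
    · refine lt_of_le_of_lt ((ContinuousMap.dist_le (by positivity : 0 ≤ ε / 2)).2 fun x => ?_)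
        (half_lt_self hε)
      change dist (f x) (((p x : ℝ) : ℂ) • f x) ≤ ε / 2
      have e : f x - ((p x : ℝ) : ℂ) • f x = ((1 - p x : ℝ) : ℂ) • f x := by
        push_cast; rw [sub_smul, one_smul]
      have h0 : 0 ≤ p x := le_max_left _ _
      have h1 : p x ≤ 1 := max_le zero_le_one (min_le_left _ _)
      rw [dist_eq_norm, e, norm_smul, Complex.norm_real, Real.norm_of_nonneg (by linarith)]
      by_cases hx : ‖f x‖ ≤ ε / 2
      · nlinarith [norm_nonneg (f x)]
      · have : p x = 1 := by
          rw [hpx, min_eq_left, max_eq_right zero_le_one]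
          rw [le_sub_iff_add_le, le_div_iff₀ hε]
          linarith
        rw [this]; simp; positivity

end Helpers

/-- If `X` is a compact Hausdorff space and `I` is a primal ideal of
`C(X,V)`, then there are `x₀ ∈ X` and a primal ideal `P` of `V` with
`I = I_{x₀,P} = {f ∈ C(X,V) : f x₀ ∈ P}`. -/
theorem exists_point_primal_of_primal
    {X : Type*} [TopologicalSpace X] [CompactSpace X] [T2Space X] [Nonempty X]
    (V : Set (H →L[ℂ] K)) (hV : IsIdealT (tri (H := H) (K := K)) V V)
    (I : Set C(X, H →L[ℂ] K)) (hI : IsPrimalT (ctri (X := X)) (CXV X V) I) :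
    ∃ (x₀ : X) (P : Set (H →L[ℂ] K)), IsPrimalT tri V P ∧
      I = {f : C(X, H →L[ℂ] K) | f ∈ CXV X V ∧ f x₀ ∈ P} := by
  obtain ⟨x₀, hx₀⟩ := exists_point hV hI
  refine ⟨x₀, {v | ContinuousMap.const X v ∈ I}, ⟨⟨?_, ?_, ?_, ?_, ?_, ?_, ?_⟩, ?_⟩, ?_⟩
  · intro v hv
    exact hI.1.subset hv x₀
  · exact hI.1.isClosed.preimage ContinuousMap.continuous_const'
  · exact hI.1.zero_mem
  · intro a b ha hb
    exact hI.1.add_mem _ _ ha hb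
  · intro c a ha
    exact hI.1.smul_mem c _ ha
  · intro a b c ha hb hc
    exact hI.1.tri_mem_left (ContinuousMap.const X a) (ContinuousMap.const X b) (ContinuousMap.const X c) ha
      (fun _ => hb) (fun _ => hc)
  · intro a b c ha hb hc
    exact hI.1.tri_mem_right (ContinuousMap.const X a) (ContinuousMap.const X b)
      (ContinuousMap.const X c) (fun _ => ha) (fun _ => hb) hc
  · intro n hn J hJ hprod
    obtain ⟨k, hk⟩ := hI.2 n hn (fun i => CXV X (J i)) (fun i => isIdeal_CXV' (hJ i))
      (fun j hj => by
        ext1 x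
        rw [oddProd_apply']
        exact hprod _ fun i => hj i x)
    exact ⟨k, fun v hv => hk fun _ => hv⟩
  · have key : ∀ f ∈ CXV X V, f - ContinuousMap.const X (f x₀) ∈ I := by
      intro f hf
      refine hx₀ _ (fun x => ?_) (by simp)
      have := hV.add_mem _ _ (hf x) (hV.smul_mem (-1) _ (hf x₀))
      simpa [sub_eq_add_neg] using this
    ext f
    constructor
    · intro hf
      have hfV := hI.1.subset hf
      refine ⟨hfV, ?_⟩
      have := hI.1.add_mem _ _ hf (hI.1.smul_mem (-1) _ (key f hfV))
      simpa using this
    · rintro ⟨hfV, hf⟩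
      have := hI.1.add_mem _ _ (key f hfV) hf
      simpa using this
end
end

section
/- Let X be a compact Hausdorff space, x_0 a point of X, and P a prime ideal of the TRO V. Then I_{x_0,P} := {f ∈ C(X,V) : f(x_0) ∈ P} is a prime ideal of C(X,V). -/
noncomputable section

open ContinuousLinearMap

variable {H K : Type*} [NormedAddCommGroup H] [InnerProductSpace ℂ H] [CompleteSpace H]
  [NormedAddCommGroup K] [InnerProductSpace ℂ K] [CompleteSpace K]

/-- `P` is a prime ideal of `V` with respect to the ternary product `t`. -/
def IsPrimeT {E : Type*} [AddCommGroup E] [Module ℂ E] [TopologicalSpace E]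
    (t : E → E → E → E) (V P : Set E) : Prop :=
  IsIdealT t V P ∧
    ∀ I J L : Set E, IsIdealT t V I → IsIdealT t V J → IsIdealT t V L →
      (∀ i ∈ I, ∀ j ∈ J, ∀ k ∈ L, t i j k ∈ P) → I ⊆ P ∨ J ⊆ P ∨ L ⊆ P

theorem tri_cont : Continuous (fun p : (H →L[ℂ] K) × (H →L[ℂ] K) × (H →L[ℂ] K) =>
    tri p.1 p.2.1 p.2.2) :=
  continuous_fst.clm_comp
    (((ContinuousLinearMap.adjoint :
        (H →L[ℂ] K) ≃ₗᵢ⋆[ℂ] (K →L[ℂ] H)).continuous.comp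
        (continuous_fst.comp continuous_snd)).clm_comp
      (continuous_snd.comp continuous_snd))

theorem closure_ideal (V S : Set (H →L[ℂ] K)) (hV : IsClosed V) (hS : S ⊆ V)
    (h0 : (0 : H →L[ℂ] K) ∈ S) (hadd : ∀ a ∈ S, ∀ b ∈ S, a + b ∈ S)
    (hsm : ∀ c : ℂ, ∀ a ∈ S, c • a ∈ S)
    (hl : ∀ a ∈ S, ∀ b ∈ V, ∀ c ∈ V, tri a b c ∈ S)
    (hr : ∀ a ∈ V, ∀ b ∈ V, ∀ c ∈ S, tri a b c ∈ S) :
    IsIdealT (tri (H := H) (K := K)) V (closure S) := by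
  refine ⟨closure_minimal hS hV, isClosed_closure, subset_closure h0, ?_, ?_, ?_, ?_⟩
  · intro a b ha hb
    exact map_mem_closure₂ continuous_add ha hb hadd
  · intro c a ha
    exact map_mem_closure (continuous_const_smul c) ha (fun a ha => hsm c a ha)
  · intro a b c ha hb hc
    have hc' : Continuous (fun a : H →L[ℂ] K => tri a b c) :=
      continuous_id.clm_comp continuous_const
    exact map_mem_closure (f := fun a : H →L[ℂ] K => tri a b c) hc' ha (fun a ha => hl a ha b hb c hc)
  · intro a b c ha hb hc
    have hc' : Continuous (fun c : H →L[ℂ] K => tri a b c) :=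
      continuous_const.clm_comp (continuous_const.clm_comp continuous_id)
    exact map_mem_closure hc' hc (fun c hc => hr a ha b hb c hc)

theorem ideal_eval_closure {X : Type*} [TopologicalSpace X] (x₀ : X)
    (V : Set (H →L[ℂ] K)) (hV : IsIdealT (tri (H := H) (K := K)) V V)
    (I : Set C(X, H →L[ℂ] K)) (hI : IsIdealT (ctri (X := X)) (CXV X V) I) :
    IsIdealT (tri (H := H) (K := K)) V
      (closure ((fun f : C(X, H →L[ℂ] K) => f x₀) '' I)) := by
  apply closure_ideal V _ hV.isClosed
  · rintro _ ⟨f, hf, rfl⟩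
    exact hI.subset hf x₀
  · exact ⟨0, hI.zero_mem, ContinuousMap.zero_apply x₀⟩
  · rintro _ ⟨f, hf, rfl⟩ _ ⟨g, hg, rfl⟩
    exact ⟨f + g, hI.add_mem _ _ hf hg, ContinuousMap.add_apply f g x₀⟩
  · rintro c _ ⟨f, hf, rfl⟩
    exact ⟨c • f, hI.smul_mem _ _ hf, ContinuousMap.smul_apply c f x₀⟩
  · rintro _ ⟨f, hf, rfl⟩ b hb c hc
    exact ⟨ctri f (ContinuousMap.const X b) (ContinuousMap.const X c),
      hI.tri_mem_left _ _ _ hf (fun _ => hb) (fun _ => hc), rfl⟩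
  · rintro a ha b hb _ ⟨f, hf, rfl⟩
    exact ⟨ctri (ContinuousMap.const X a) (ContinuousMap.const X b) f,
      hI.tri_mem_right _ _ _ (fun _ => ha) (fun _ => hb) hf, rfl⟩

/-- If `X` is a compact Hausdorff space, `x₀ ∈ X` and `P` is a prime
ideal of the TRO `V`, then `I_{x₀,P} = {f ∈ C(X,V) : f x₀ ∈ P}` is a prime ideal of
`C(X,V)`. -/
theorem prime_eval_ideal_of_prime
    {X : Type*} [TopologicalSpace X] [CompactSpace X] [T2Space X] (x₀ : X)
    (V : Set (H →L[ℂ] K)) (hV : IsIdealT (tri (H := H) (K := K)) V V)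
    (P : Set (H →L[ℂ] K)) (hP : IsPrimeT tri V P) :
    IsPrimeT (ctri (X := X)) (CXV X V)
      {f : C(X, H →L[ℂ] K) | f ∈ CXV X V ∧ f x₀ ∈ P} := by
  have hev : ∀ x : X, Continuous (fun f : C(X, H →L[ℂ] K) => f x) :=
    fun x => continuous_eval_const x
  obtain ⟨hPi, hPp⟩ := hP
  refine ⟨⟨fun f hf => hf.1, ?_, ⟨fun _ => hV.zero_mem, hPi.zero_mem⟩, ?_, ?_, ?_, ?_⟩, ?_⟩
  · have h1 : IsClosed (CXV X V) := by
      have : CXV X V = ⋂ x : X, (fun f : C(X, H →L[ℂ] K) => f x) ⁻¹' V := by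
        ext f; simp [CXV]
      rw [this]
      exact isClosed_iInter fun x => hV.isClosed.preimage (hev x)
    exact h1.inter (hPi.isClosed.preimage (hev x₀))
  · intro a b ha hb
    exact ⟨fun x => hV.add_mem _ _ (ha.1 x) (hb.1 x), hPi.add_mem _ _ ha.2 hb.2⟩
  · intro c a ha
    exact ⟨fun x => hV.smul_mem c _ (ha.1 x), hPi.smul_mem c _ ha.2⟩
  · intro a b c ha hb hc
    exact ⟨fun x => hV.tri_mem_left _ _ _ (ha.1 x) (hb x) (hc x),
      hPi.tri_mem_left _ _ _ ha.2 (hb x₀) (hc x₀)⟩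
  · intro a b c ha hb hc
    exact ⟨fun x => hV.tri_mem_right _ _ _ (ha x) (hb x) (hc.1 x),
      hPi.tri_mem_right _ _ _ (ha x₀) (hb x₀) hc.2⟩
  · intro I J L hI hJ hL h
    have key := hPp _ _ _ (ideal_eval_closure x₀ V hV I hI) (ideal_eval_closure x₀ V hV J hJ)
      (ideal_eval_closure x₀ V hV L hL) (by
        intro i hi j hj k hk
        have hm : (i, j, k) ∈ closure (((fun f : C(X, H →L[ℂ] K) => f x₀) '' I) ×ˢ
            (((fun f : C(X, H →L[ℂ] K) => f x₀) '' J) ×ˢ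
              ((fun f : C(X, H →L[ℂ] K) => f x₀) '' L))) := by
          rw [closure_prod_eq, closure_prod_eq]
          exact ⟨hi, hj, hk⟩
        rw [← hPi.isClosed.closure_eq]
        refine map_mem_closure (f := fun p : (H →L[ℂ] K) × (H →L[ℂ] K) × (H →L[ℂ] K) =>
          tri p.1 p.2.1 p.2.2) tri_cont hm ?_
        rintro ⟨_, _, _⟩ ⟨⟨f, hf, rfl⟩, ⟨g, hg, rfl⟩, ⟨k, hk, rfl⟩⟩
        exact (h f hf g hg k hk).2)
    rcases key with h | h | h
    · exact Or.inl fun f hf => ⟨hI.subset hf, h (subset_closure ⟨f, hf, rfl⟩)⟩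
    · exact Or.inr (Or.inl fun f hf => ⟨hJ.subset hf, h (subset_closure ⟨f, hf, rfl⟩)⟩)
    · exact Or.inr (Or.inr fun f hf => ⟨hL.subset hf, h (subset_closure ⟨f, hf, rfl⟩)⟩)
end
end

section
/- Let X be a compact Hausdorff space, let I_1, I_2 be proper ideals of the TRO V, and let F_1, F_2 be nonempty closed subsets of X. If {f ∈ C(X,V) : f(x) ∈ I_1 for all x ∈ F_1} = {f ∈ C(X,V) : f(x) ∈ I_2 for all x ∈ F_2}, then I_1 = I_2 and F_1 = F_2. -/
noncomputable section

open ContinuousLinearMap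

variable {H K : Type*} [NormedAddCommGroup H] [InnerProductSpace ℂ H] [CompleteSpace H]
  [NormedAddCommGroup K] [InnerProductSpace ℂ K] [CompleteSpace K]

theorem aux_subset
    {X : Type*} [TopologicalSpace X] [CompactSpace X] [T2Space X]
    (V : Set (H →L[ℂ] K)) (hV : IsIdealT (tri (H := H) (K := K)) V V)
    (I₁ I₂ : Set (H →L[ℂ] K))
    (hI₁ : IsIdealT tri V I₁)
    (hI₂ : IsIdealT tri V I₂) (hI₂proper : I₂ ≠ V)
    (F₁ F₂ : Set X) (hF₁c : IsClosed F₁) (hF₂n : F₂.Nonempty)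
    (hsub : ∀ f : C(X, H →L[ℂ] K), (∀ x, f x ∈ V) → (∀ x ∈ F₁, f x ∈ I₁) →
      ∀ x ∈ F₂, f x ∈ I₂) :
    I₁ ⊆ I₂ ∧ F₂ ⊆ F₁ := by
  constructor
  · intro a ha
    obtain ⟨x, hx⟩ := hF₂n
    exact hsub (ContinuousMap.const X a) (fun _ => hI₁.subset ha) (fun _ _ => ha) x hx
  · intro x hx
    by_contra hx1
    obtain ⟨v, hv, hv2⟩ : ∃ v ∈ V, v ∉ I₂ := by
      by_contra hcon
      push Not at hcon
      exact hI₂proper (Set.Subset.antisymm hI₂.subset hcon)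
    obtain ⟨g, hg0, hg1, -⟩ := exists_continuous_zero_one_of_isClosed hF₁c
      (isClosed_singleton (x := x)) (Set.disjoint_singleton_right.2 hx1)
    have h := hsub ⟨fun y => ((g y : ℝ) : ℂ) • v, by fun_prop⟩
      (fun y => hV.smul_mem _ _ hv)
      (fun y hy => by
        have h0 : g y = 0 := hg0 hy
        simpa [h0] using hI₁.zero_mem) x hx
    have h1 : g x = 1 := hg1 rfl
    simp [h1] at h
    exact hv2 h

/-- Let `X` be a compact Hausdorff space, `I₁, I₂` proper ideals of
the TRO `V`, and `F₁, F₂` nonempty closed subsets of `X`. If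
`{f ∈ C(X,V) : f x ∈ I₁ for all x ∈ F₁} = {f ∈ C(X,V) : f x ∈ I₂ for all x ∈ F₂}`,
then `I₁ = I₂` and `F₁ = F₂`. -/
theorem eq_of_eval_ideals_eq
    {X : Type*} [TopologicalSpace X] [CompactSpace X] [T2Space X]
    (V : Set (H →L[ℂ] K)) (hV : IsIdealT (tri (H := H) (K := K)) V V)
    (I₁ I₂ : Set (H →L[ℂ] K))
    (hI₁ : IsIdealT tri V I₁) (hI₁proper : I₁ ≠ V)
    (hI₂ : IsIdealT tri V I₂) (hI₂proper : I₂ ≠ V)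
    (F₁ F₂ : Set X) (hF₁c : IsClosed F₁) (hF₁n : F₁.Nonempty)
    (hF₂c : IsClosed F₂) (hF₂n : F₂.Nonempty)
    (heq : {f : C(X, H →L[ℂ] K) | f ∈ CXV X V ∧ ∀ x ∈ F₁, f x ∈ I₁} =
           {f : C(X, H →L[ℂ] K) | f ∈ CXV X V ∧ ∀ x ∈ F₂, f x ∈ I₂}) :
    I₁ = I₂ ∧ F₁ = F₂ := by
  have h12 := aux_subset V hV I₁ I₂ hI₁ hI₂ hI₂proper F₁ F₂ hF₁c hF₂n (fun f hf h =>
    ((Set.ext_iff.1 heq f).1 ⟨hf, h⟩).2)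
  have h21 := aux_subset V hV I₂ I₁ hI₂ hI₁ hI₁proper F₂ F₁ hF₂c hF₁n (fun f hf h =>
    ((Set.ext_iff.1 heq f).2 ⟨hf, h⟩).2)
  exact ⟨Set.Subset.antisymm h12.1 h21.1, Set.Subset.antisymm h21.2 h12.2⟩
end
end

section
/- Let X be a compact Hausdorff space. The map Φ_X sending a pair (I, F), where I is a proper ideal of the TRO V and F is a nonempty closed subset of X, to the proper ideal {f ∈ C(X,V) : f(x) ∈ I for all x ∈ F} of C(X,V), is a homeomorphism from Id'(V) × F(X) onto its image in Id'(C(X,V)), where Id'(V) and Id'(C(X,V)) carry the topology τ_w and F(X) carries the lower Vietoris topology. -/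
noncomputable section

open ContinuousLinearMap

variable {H K : Type*} [NormedAddCommGroup H] [InnerProductSpace ℂ H] [CompleteSpace H]
  [NormedAddCommGroup K] [InnerProductSpace ℂ K] [CompleteSpace K]

/-- The space `Id'(V)` of proper (closed) ideals of `V`, with respect to the ternary
product `t`. -/
def IdP {E : Type*} [AddCommGroup E] [Module ℂ E] [TopologicalSpace E]
    (t : E → E → E → E) (V : Set E) : Type _ :=
  {I : Set E // IsIdealT t V I ∧ I ≠ V}

/-- The topology `τ_w` on `Id'(V)`, generated by the sub-basic sets
`U(J) = {I ∈ Id'(V) : ¬ J ⊆ I}`, `J` an ideal of `V`. -/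
instance {E : Type*} [AddCommGroup E] [Module ℂ E] [TopologicalSpace E]
    (t : E → E → E → E) (V : Set E) : TopologicalSpace (IdP t V) :=
  TopologicalSpace.generateFrom
    {U | ∃ J : Set E, IsIdealT t V J ∧ U = {I : IdP t V | ¬ J ⊆ I.1}}

/-- The space `F(X)` of nonempty closed subsets of `X`. -/
def ClosedNE (X : Type*) [TopologicalSpace X] : Type _ :=
  {F : Set X // IsClosed F ∧ F.Nonempty}

/-- The lower Vietoris topology on `F(X)`, generated by the sets
`{F : F ∩ U ≠ ∅}`, `U ⊆ X` open. -/
instance (X : Type*) [TopologicalSpace X] : TopologicalSpace (ClosedNE X) :=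
  TopologicalSpace.generateFrom
    {S | ∃ U : Set X, IsOpen U ∧ S = {F : ClosedNE X | (F.1 ∩ U).Nonempty}}

section Helpers

theorem hp_tri_eq (x y z : H →L[ℂ] K) : tri x y z = (x ∘L adjoint y) ∘L z := rfl

theorem hp_tri_eq2 (x y z : H →L[ℂ] K) : tri x y z = x ∘L (adjoint y ∘L z) := rfl

theorem hp_nonneg (a : H →L[ℂ] K) : 0 ≤ adjoint a ∘L a := by
  rw [ContinuousLinearMap.nonneg_iff_isPositive]
  exact ContinuousLinearMap.isPositive_adjoint_comp_self a

theorem hp_sa (a : H →L[ℂ] K) : IsSelfAdjoint (adjoint a ∘L a) :=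
  IsSelfAdjoint.of_nonneg (hp_nonneg a)

theorem hp_sub {E : Type*} [AddCommGroup E] [Module ℂ E] [TopologicalSpace E]
    {t : E → E → E → E} {V I : Set E} (hI : IsIdealT t V I) {a b : E} (ha : a ∈ I) (hb : b ∈ I) :
    a - b ∈ I := by
  have := hI.add_mem _ _ ha (hI.smul_mem (-1) _ hb)
  simpa [sub_eq_add_neg] using this

/-- The right multipliers of `I`. -/
def hpMult {V I : Set (H →L[ℂ] K)} (hI : IsIdealT tri V I) : StarSubalgebra ℝ (H →L[ℂ] H) where
  carrier := {T | ∀ i ∈ I, i ∘L T ∈ I ∧ i ∘L (star T) ∈ I}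
  mul_mem' := by
    intro S T hS hT i hi
    refine ⟨?_, ?_⟩
    · exact (hT _ (hS i hi).1).1
    · rw [star_mul]
      exact (hS _ (hT i hi).2).2
  add_mem' := by
    intro S T hS hT i hi
    refine ⟨?_, ?_⟩
    · rw [comp_add]; exact hI.add_mem _ _ (hS i hi).1 (hT i hi).1
    · rw [star_add, comp_add]; exact hI.add_mem _ _ (hS i hi).2 (hT i hi).2
  algebraMap_mem' := by
    intro r i hi
    have h1 : i ∘L (algebraMap ℝ (H →L[ℂ] H) r) = (r : ℂ) • i := by
      ext x
      simp [Algebra.algebraMap_eq_smul_one]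
    refine ⟨?_, ?_⟩
    · rw [h1]; exact hI.smul_mem _ _ hi
    · rw [← algebraMap_star_comm, star_trivial, h1]; exact hI.smul_mem _ _ hi
  star_mem' := by
    intro T hT i hi
    exact ⟨(hT i hi).2, by rw [star_star]; exact (hT i hi).1⟩

theorem hp_mult_closed {V I : Set (H →L[ℂ] K)} (hI : IsIdealT tri V I) :
    IsClosed (hpMult hI : Set (H →L[ℂ] H)) := by
  have : (hpMult hI : Set (H →L[ℂ] H)) =
      ⋂ i ∈ I, ({T | i ∘L T ∈ I} ∩ {T | i ∘L (star T) ∈ I}) := by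
    ext T
    simp [hpMult]
  rw [this]
  refine isClosed_biInter fun i _ => IsClosed.inter ?_ ?_
  · exact hI.isClosed.preimage (continuous_const.clm_comp continuous_id)
  · exact hI.isClosed.preimage ((continuous_const (y := i)).clm_comp (continuous_star (R := H →L[ℂ] H)))

theorem hp_cfc_mem {V I : Set (H →L[ℂ] K)} (hI : IsIdealT tri V I) {a i : H →L[ℂ] K}
    (ha : a ∈ V) (hi : i ∈ I) (q : ℝ → ℝ) : i ∘L cfc q (adjoint a ∘L a) ∈ I := by
  have h1 : adjoint a ∘L a ∈ hpMult hI := by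
    intro j hj
    have h2 : star (adjoint a ∘L a) = adjoint a ∘L a := hp_sa a
    rw [h2]
    have := hI.tri_mem_left j a a hj ha ha
    exact ⟨this, this⟩
  have h3 := StarAlgebra.elemental.le_of_mem (hp_mult_closed hI) h1
    (cfc_mem_elemental q (adjoint a ∘L a))
  exact (h3 i hi).1

theorem hp_mem_closed_approx {I : Set (H →L[ℂ] K)} (hc : IsClosed I) {a : H →L[ℂ] K}
    (h : ∀ ε > 0, ∃ b ∈ I, ‖a - b‖ ≤ ε) : a ∈ I := by
  rw [← hc.closure_eq, Metric.mem_closure_iff]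
  intro ε hε
  obtain ⟨b, hb, h2⟩ := h (ε/2) (by positivity)
  exact ⟨b, hb, by rw [dist_eq_norm]; linarith⟩

theorem hp_cube {V I : Set (H →L[ℂ] K)} (hI : IsIdealT tri V I) {a : H →L[ℂ] K}
    (ha : a ∈ V) (h3 : tri a a a ∈ I) : a ∈ I := by
  refine hp_mem_closed_approx hI.isClosed fun ε hε => ?_
  set h := adjoint a ∘L a with hh
  have hsa : IsSelfAdjoint h := hp_sa a
  have hsp : ∀ t ∈ spectrum ℝ h, 0 ≤ t := fun t ht => spectrum_nonneg_of_nonneg (hp_nonneg a) ht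
  set η : ℝ := ε ^ 2 with hη
  have hηp : 0 < η := by positivity
  refine ⟨tri a a a ∘L cfc (fun t : ℝ => 1 / (t + η)) h, hp_cfc_mem hI ha h3 _, ?_⟩
  have hne : ∀ t ∈ spectrum ℝ h, t + η ≠ 0 := fun t ht => by have := hsp t ht; positivity
  have c1 : ContinuousOn (fun t : ℝ => 1 / (t + η)) (spectrum ℝ h) :=
    continuousOn_const.div (by fun_prop) hne
  have c2 : ContinuousOn (fun t : ℝ => η / (t + η)) (spectrum ℝ h) :=
    continuousOn_const.div (by fun_prop) hne
  set T := cfc (fun t : ℝ => η / (t + η)) h with hT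
  have e1 : 1 - h * cfc (fun t : ℝ => 1 / (t + η)) h = T := by
    have : h * cfc (fun t : ℝ => 1 / (t + η)) h = cfc (fun t : ℝ => t * (1 / (t + η))) h := by
      rw [cfc_mul (fun t : ℝ => t) _ h continuousOn_id c1, cfc_id' ℝ h]
    rw [this, ← cfc_one ℝ h, ← cfc_sub (1 : ℝ → ℝ) (fun t : ℝ => t * (1 / (t + η))) h continuousOn_const (continuousOn_id.mul c1)]
    refine cfc_congr fun t ht => ?_
    have := hne t ht
    simp only [Pi.one_apply]
    field_simp
    ring
  have e2 : a - tri a a a ∘L cfc (fun t : ℝ => 1 / (t + η)) h = a ∘L T := by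
    rw [← e1, comp_sub]
    rfl
  rw [e2]
  have hTs : star T = T := (cfc_predicate (fun t : ℝ => η / (t + η)) h : IsSelfAdjoint T)
  have e3 : adjoint (a ∘L T) ∘L (a ∘L T) = cfc (fun t : ℝ => η / (t + η) * (t * (η / (t + η)))) h := by
    rw [cfc_mul (fun t : ℝ => η / (t + η)) (fun t : ℝ => t * (η / (t + η))) h c2
      (continuousOn_id.mul c2), cfc_mul (fun t : ℝ => t) _ h continuousOn_id c2, cfc_id' ℝ h]
    rw [adjoint_comp]
    have : adjoint T = T := hTs
    rw [this]
    rfl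
  have e4 : ‖a ∘L T‖ * ‖a ∘L T‖ ≤ ε * ε := by
    rw [← norm_adjoint_comp_self, e3]
    refine norm_cfc_le (by positivity) fun t ht => ?_
    have ht0 := hsp t ht
    rw [Real.norm_of_nonneg (by positivity)]
    have : ε * ε = η := by rw [hη]; ring
    rw [this]
    have h5 : η / (t + η) ≤ 1 := by rw [div_le_one (by positivity)]; linarith
    have h6 : t * (η / (t + η)) ≤ η := by
      rw [← mul_div_assoc, div_le_iff₀ (by positivity)]; nlinarith
    have h7 : 0 ≤ t * (η / (t + η)) := by positivity
    nlinarith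
  exact abs_le_of_sq_le_sq' (by nlinarith) hε.le |>.2

theorem hp_middle {V I : Set (H →L[ℂ] K)} (hV : IsIdealT tri V V) (hI : IsIdealT tri V I)
    {a b c : H →L[ℂ] K} (ha : a ∈ V) (hb : b ∈ I) (hc : c ∈ V) : tri a b c ∈ I := by
  have hbV := hI.subset hb
  have hd : tri a b c ∈ V := hV.tri_mem_left _ _ _ ha hbV hc
  refine hp_cube hI hd ?_
  have e : tri (tri a b c) (tri a b c) (tri a b c) =
      tri (tri a b (tri c c b)) a (tri a b c) := by
    simp only [tri, adjoint_comp, adjoint_adjoint, comp_assoc]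
  rw [e]
  exact hI.tri_mem_left _ _ _ (hI.tri_mem_right _ _ _ ha hbV (hI.tri_mem_right _ _ _ hc hc hb)) ha hd

/-- iterated odd power -/
def hpPow (a : H →L[ℂ] K) (n : ℕ) : H →L[ℂ] K := a ∘L ((adjoint a ∘L a) ^ n)

theorem hp_pow_succ (a : H →L[ℂ] K) (n : ℕ) : hpPow a (n+1) = tri (hpPow a n) a a := by
  simp only [hpPow, pow_succ]
  rfl

theorem hp_pow_mem {V : Set (H →L[ℂ] K)} (hV : IsIdealT tri V V) {a : H →L[ℂ] K} (ha : a ∈ V)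
    (n : ℕ) : hpPow a n ∈ V := by
  induction n with
  | zero => simpa [hpPow, one_def] using ha
  | succ n ih => rw [hp_pow_succ]; exact hV.tri_mem_left _ _ _ ih ha ha

theorem hp_pow_sub_mem {V I : Set (H →L[ℂ] K)} (hV : IsIdealT tri V V) (hI : IsIdealT tri V I)
    {a b : H →L[ℂ] K} (ha : a ∈ V) (hb : b ∈ I) (n : ℕ) :
    hpPow a n - hpPow (a - b) n ∈ I := by
  have hd : a - b ∈ V := hp_sub hV ha (hI.subset hb)
  induction n with
  | zero => simpa [hpPow, one_def] using hb
  | succ n ih =>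
    have e : hpPow a (n+1) - hpPow (a - b) (n+1) =
        tri (hpPow a n - hpPow (a - b) n) a a +
          (tri (hpPow (a - b) n) (a - b) b + tri (hpPow (a - b) n) b a) := by
      rw [hp_pow_succ, hp_pow_succ]
      generalize hpPow a n = p
      generalize hpPow (a - b) n = q
      simp only [tri, map_sub, comp_sub, sub_comp]
      abel
    rw [e]
    exact hI.add_mem _ _ (hI.tri_mem_left _ _ _ ih ha ha)
      (hI.add_mem _ _ (hI.tri_mem_right _ _ _ (hp_pow_mem hV hd n) hd hb)
        (hp_middle hV hI (hp_pow_mem hV hd n) hb ha))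

theorem hp_pow_norm (a : H →L[ℂ] K) (n : ℕ) : ‖hpPow a n‖ ≤ ‖a‖ * (‖a‖ ^ 2) ^ n := by
  induction n with
  | zero => simp [hpPow, one_def]
  | succ n ih =>
    rw [hp_pow_succ, hp_tri_eq2]
    calc _ ≤ ‖hpPow a n‖ * ‖adjoint a ∘L a‖ := opNorm_comp_le _ _
      _ ≤ (‖a‖ * (‖a‖ ^ 2) ^ n) * (‖a‖ * ‖a‖) := by
        rw [norm_adjoint_comp_self]; gcongr
      _ = _ := by ring

/-- truncation of `a` -/
def hpCut (a : H →L[ℂ] K) (δ : ℝ) : H →L[ℂ] K :=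
  a ∘L cfc (fun t : ℝ => max (t - δ) 0) (adjoint a ∘L a)

theorem hp_cut_mem {V I : Set (H →L[ℂ] K)} (hV : IsIdealT tri V V) (hI : IsIdealT tri V I)
    {a b : H →L[ℂ] K} (ha : a ∈ V) (hb : b ∈ I) {δ : ℝ} (hδ : 0 < δ) (hab : ‖a - b‖ ^ 2 < δ) :
    hpCut a δ ∈ I := by
  refine hp_mem_closed_approx hI.isClosed fun ε hε => ?_
  set h := adjoint a ∘L a with hh
  have hsa : IsSelfAdjoint h := hp_sa a
  have hsp : ∀ t ∈ spectrum ℝ h, 0 ≤ t := fun t ht => spectrum_nonneg_of_nonneg (hp_nonneg a) ht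
  have hsn : ∀ t ∈ spectrum ℝ h, t ≤ ‖h‖ * ‖(1 : H →L[ℂ] H)‖ := fun t ht =>
    (le_abs_self t).trans (spectrum.norm_le_norm_mul_of_mem ht)
  set M := ‖h‖ * ‖(1 : H →L[ℂ] H)‖ with hM
  have hM0 : 0 ≤ M := by positivity
  set d := a - b with hd
  set r := ‖d‖ ^ 2 / δ with hr
  have hr1 : r < 1 := by rw [hr, div_lt_one hδ]; exact hab
  have hr0 : 0 ≤ r := by positivity
  have ht : Filter.Tendsto (fun n => ‖d‖ * M * r ^ n) Filter.atTop (nhds 0) := by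
    simpa using (tendsto_pow_atTop_nhds_zero_of_lt_one hr0 hr1).const_mul (‖d‖ * M)
  obtain ⟨n, hn⟩ := (ht.eventually (gt_mem_nhds hε)).exists
  set ψ : ℝ → ℝ := fun t => max (t - δ) 0 / (max t δ) ^ n with hψ
  have hmp : ∀ t : ℝ, 0 < max t δ := fun t => lt_max_of_lt_right hδ
  have hψc : Continuous ψ := by
    rw [hψ]
    exact Continuous.div (by fun_prop) (by fun_prop) fun t => (pow_pos (hmp t) n).ne'
  have e1 : hpCut a δ = hpPow a n ∘L cfc ψ h := by
    have : cfc (fun t : ℝ => max (t - δ) 0) h = h ^ n * cfc ψ h := by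
      rw [← cfc_pow_id (R := ℝ) h n, ← cfc_mul _ _ h (by fun_prop) hψc.continuousOn]
      refine cfc_congr fun t ht => ?_
      simp only [hψ]
      rcases le_total t δ with h1 | h1
      · rw [max_eq_right (by linarith : t - δ ≤ 0)]; simp
      · rw [max_eq_left h1]
        have : t ≠ 0 := by linarith
        field_simp
    rw [hpCut, ← hh, this]
    rfl
  refine ⟨(hpPow a n - hpPow d n) ∘L cfc ψ h,
    hp_cfc_mem hI ha (hp_pow_sub_mem hV hI ha hb n) ψ, ?_⟩
  have e2 : hpCut a δ - (hpPow a n - hpPow d n) ∘L cfc ψ h = hpPow d n ∘L cfc ψ h := by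
    rw [e1, sub_comp]; abel
  rw [e2]
  have e3 : ‖cfc ψ h‖ ≤ M / δ ^ n := by
    refine norm_cfc_le (by positivity) fun t ht => ?_
    have := hmp t
    have hm0 : 0 ≤ max (t - δ) 0 := le_max_right _ _
    rw [Real.norm_of_nonneg (by positivity)]
    simp only [hψ]
    have : max (t - δ) 0 ≤ M := max_le (by linarith [hsn t ht]) hM0
    gcongr
    exact le_max_right _ _
  calc _ ≤ ‖hpPow d n‖ * ‖cfc ψ h‖ := opNorm_comp_le _ _
    _ ≤ (‖d‖ * (‖d‖ ^ 2) ^ n) * (M / δ ^ n) := by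
      gcongr; exact hp_pow_norm d n
    _ = ‖d‖ * M * r ^ n := by rw [hr, div_pow]; ring
    _ ≤ ε := hn.le

theorem hp_cut_not_mem {V I : Set (H →L[ℂ] K)} (hI : IsIdealT tri V I)
    {a : H →L[ℂ] K} (ha : a ∈ V) (hn : a ∉ I) : ∃ δ > 0, hpCut a δ ∉ I := by
  by_contra! hcon
  apply hn
  refine hp_cube hI ha (hp_mem_closed_approx hI.isClosed fun ε hε => ?_)
  have hδ : 0 < ε / (‖a‖ + 1) := by positivity
  set δ := ε / (‖a‖ + 1)
  refine ⟨_, hcon δ hδ, ?_⟩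
  set h := adjoint a ∘L a with hh
  have hsa : IsSelfAdjoint h := hp_sa a
  have hsp : ∀ t ∈ spectrum ℝ h, 0 ≤ t := fun t ht => spectrum_nonneg_of_nonneg (hp_nonneg a) ht
  have e1 : tri a a a - hpCut a δ = a ∘L cfc (fun t : ℝ => t - max (t - δ) 0) h := by
    rw [cfc_sub (fun t : ℝ => t) _ h (by fun_prop) (by fun_prop), cfc_id' ℝ h, comp_sub]
    rfl
  rw [e1]
  have e2 : ‖cfc (fun t : ℝ => t - max (t - δ) 0) h‖ ≤ δ := by
    refine norm_cfc_le hδ.le fun t ht => ?_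
    have := hsp t ht
    rw [Real.norm_eq_abs, abs_le]
    rcases max_cases (t - δ) 0 with h1 | h1 <;> constructor <;> linarith
  calc _ ≤ ‖a‖ * ‖cfc (fun t : ℝ => t - max (t - δ) 0) h‖ := opNorm_comp_le _ _
    _ ≤ (‖a‖ + 1) * δ := by gcongr; linarith
    _ = ε := by simp only [δ]; field_simp

theorem hp_cut_V {V : Set (H →L[ℂ] K)} (hV : IsIdealT tri V V)
    {a : H →L[ℂ] K} (ha : a ∈ V) (δ : ℝ) : hpCut a δ ∈ V := hp_cfc_mem hV ha ha _

/-- generated ideal -/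
def hpGen (V : Set (H →L[ℂ] K)) (g : H →L[ℂ] K) : Set (H →L[ℂ] K) :=
  {v | v ∈ V ∧ ∀ I, IsIdealT tri V I → g ∈ I → v ∈ I}

theorem hp_gen_ideal {V : Set (H →L[ℂ] K)} (hV : IsIdealT tri V V) (g : H →L[ℂ] K) :
    IsIdealT tri V (hpGen V g) where
  subset := fun _ h => h.1
  isClosed := by
    have : hpGen V g = V ∩ ⋂ (I : Set (H →L[ℂ] K)) (_ : IsIdealT tri V I) (_ : g ∈ I), I := by
      ext v; simp [hpGen]
    rw [this]
    exact hV.isClosed.inter (isClosed_iInter fun I => isClosed_iInter fun hI =>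
      isClosed_iInter fun _ => hI.isClosed)
  zero_mem := ⟨hV.zero_mem, fun _ hI _ => hI.zero_mem⟩
  add_mem := fun a b ha hb => ⟨hV.add_mem _ _ ha.1 hb.1, fun I hI hg =>
    hI.add_mem _ _ (ha.2 I hI hg) (hb.2 I hI hg)⟩
  smul_mem := fun c a ha => ⟨hV.smul_mem _ _ ha.1, fun I hI hg =>
    hI.smul_mem _ _ (ha.2 I hI hg)⟩
  tri_mem_left := fun a b c ha hb hc => ⟨hV.tri_mem_left _ _ _ ha.1 hb hc, fun I hI hg =>
    hI.tri_mem_left _ _ _ (ha.2 I hI hg) hb hc⟩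
  tri_mem_right := fun a b c ha hb hc => ⟨hV.tri_mem_right _ _ _ ha hb hc.1, fun I hI hg =>
    hI.tri_mem_right _ _ _ ha hb (hc.2 I hI hg)⟩

/-- the general fibrewise ideal -/
def hpFib (X : Type*) [TopologicalSpace X] (V : Set (H →L[ℂ] K)) (A : X → Set (H →L[ℂ] K)) :
    Set C(X, H →L[ℂ] K) := {f | f ∈ CXV X V ∧ ∀ x, f x ∈ A x}

theorem hp_fib_ideal {X : Type*} [TopologicalSpace X] [CompactSpace X] {V : Set (H →L[ℂ] K)}
    (hV : IsIdealT tri V V) (A : X → Set (H →L[ℂ] K)) (hA : ∀ x, IsIdealT tri V (A x)) :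
    IsIdealT (ctri (X := X)) (CXV X V) (hpFib X V A) where
  subset := fun _ h => h.1
  isClosed := by
    have : hpFib X V A = ⋂ x, ({f : C(X, H →L[ℂ] K) | f x ∈ V} ∩ {f | f x ∈ A x}) := by
      ext f; simp [hpFib, CXV, forall_and]
    rw [this]
    exact isClosed_iInter fun x =>
      (hV.isClosed.preimage (continuous_eval_const x)).inter
        ((hA x).isClosed.preimage (continuous_eval_const x))
  zero_mem := ⟨fun _ => hV.zero_mem, fun x => (hA x).zero_mem⟩
  add_mem := fun a b ha hb => ⟨fun x => hV.add_mem _ _ (ha.1 x) (hb.1 x), fun x =>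
    (hA x).add_mem _ _ (ha.2 x) (hb.2 x)⟩
  smul_mem := fun c a ha => ⟨fun x => hV.smul_mem _ _ (ha.1 x), fun x =>
    (hA x).smul_mem _ _ (ha.2 x)⟩
  tri_mem_left := fun a b c ha hb hc => ⟨fun x => hV.tri_mem_left _ _ _ (ha.1 x) (hb x) (hc x),
    fun x => (hA x).tri_mem_left _ _ _ (ha.2 x) (hb x) (hc x)⟩
  tri_mem_right := fun a b c ha hb hc => ⟨fun x => hV.tri_mem_right _ _ _ (ha x) (hb x) (hc.1 x),
    fun x => (hA x).tri_mem_right _ _ _ (ha x) (hb x) (hc.2 x)⟩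

theorem hp_zero_ideal {V : Set (H →L[ℂ] K)} (hV : IsIdealT tri V V) :
    IsIdealT tri V ({0} : Set (H →L[ℂ] K)) where
  subset := by rintro _ rfl; exact hV.zero_mem
  isClosed := isClosed_singleton
  zero_mem := rfl
  add_mem := by rintro _ _ rfl rfl; simp
  smul_mem := by rintro c _ rfl; simp
  tri_mem_left := by rintro _ b c rfl _ _; simp [tri]
  tri_mem_right := by rintro a b _ _ _ rfl; simp [tri]

open Classical in
theorem hp_fib_ite {X : Type*} {V I J : Set (H →L[ℂ] K)} (hI : IsIdealT tri V I)
    (hJ : IsIdealT tri V J) (F : Set X) (x : X) : IsIdealT tri V (if x ∈ F then I else J) := by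
  split_ifs <;> assumption

/-- bump times vector -/
theorem hp_bump {X : Type*} [TopologicalSpace X] [CompactSpace X] [T2Space X]
    {U : Set X} (hU : IsOpen U) {x : X} (hx : x ∈ U) (v : H →L[ℂ] K) :
    ∃ f : C(X, H →L[ℂ] K), f x = v ∧ (∀ y ∉ U, f y = 0) ∧ ∀ y, ∃ c : ℂ, f y = c • v := by
  obtain ⟨g, g0, g1, -⟩ := exists_continuous_zero_one_of_isClosed hU.isClosed_compl
    (isClosed_singleton (x := x)) (by simpa using hx)
  refine ⟨⟨fun y => (g y : ℂ) • v, by fun_prop⟩, ?_, ?_, ?_⟩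
  · have : g x = 1 := g1 rfl
    simp [this]
  · intro y hy
    have : g y = 0 := g0 hy
    simp [this]
  · exact fun y => ⟨g y, rfl⟩

open Classical in
/-- The image ideal. -/
def hpPhi (X : Type*) [TopologicalSpace X] [CompactSpace X] {V : Set (H →L[ℂ] K)}
    (hV : IsIdealT tri V V) (p : IdP (tri (H := H) (K := K)) V × ClosedNE X) :
    IdP (ctri (X := X)) (CXV X V) :=
  ⟨{f | f ∈ CXV X V ∧ ∀ x ∈ p.2.1, f x ∈ p.1.1}, by
    obtain ⟨⟨I, hI, hne⟩, ⟨F, hF, x, hx⟩⟩ := p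
    refine ⟨?_, ?_⟩
    · have := hp_fib_ideal (X := X) hV _ (hp_fib_ite hI hV F)
      convert this using 1
      ext f
      refine and_congr_right fun hf => forall_congr' fun x => ?_
      by_cases hx : x ∈ F
      · simp [hx]
      · simpa [hx] using hf x
    · intro heq
      apply hne
      refine subset_antisymm hI.subset fun v hv => ?_
      have : ContinuousMap.const X v ∈ CXV X V := fun _ => hv
      rw [← heq] at this
      exact this.2 x hx⟩

theorem hp_phi_not_sub {X : Type*} [TopologicalSpace X] [CompactSpace X] {V : Set (H →L[ℂ] K)}
    (hV : IsIdealT tri V V) {J : Set C(X, H →L[ℂ] K)} (hJ : J ⊆ CXV X V)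
    (p : IdP (tri (H := H) (K := K)) V × ClosedNE X) :
    ¬ J ⊆ (hpPhi X hV p).1 ↔ ∃ f ∈ J, ∃ x ∈ p.2.1, f x ∉ p.1.1 := by
  rw [Set.not_subset]
  refine exists_congr fun f => and_congr_right fun hf => ?_
  simp [hpPhi, hJ hf]

theorem hp_phi_continuous {X : Type*} [TopologicalSpace X] [CompactSpace X]
    {V : Set (H →L[ℂ] K)} (hV : IsIdealT tri V V) : Continuous (hpPhi X hV) := by
  refine continuous_generateFrom_iff.2 ?_
  rintro _ ⟨J, hJ, rfl⟩
  rw [isOpen_iff_mem_nhds]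
  rintro p hp
  obtain ⟨f, hf, x, hx, hfx⟩ := (hp_phi_not_sub hV hJ.subset p).1 hp
  have haV : f x ∈ V := hJ.subset hf x
  obtain ⟨δ, hδ, hcut⟩ := hp_cut_not_mem p.1.2.1 haV hfx
  set L := hpGen V (hpCut (f x) δ)
  have hL := hp_gen_ideal hV (hpCut (f x) δ)
  have hgL : hpCut (f x) δ ∈ L := ⟨hp_cut_V hV haV δ, fun _ _ h => h⟩
  set U : Set X := {y | ‖f x - f y‖ ^ 2 < δ}
  have hU : IsOpen U := isOpen_lt (by fun_prop) continuous_const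
  have o1 : IsOpen {I : IdP (tri (H := H) (K := K)) V | ¬ L ⊆ I.1} :=
    TopologicalSpace.isOpen_generateFrom_of_mem ⟨L, hL, rfl⟩
  have o2 : IsOpen {F : ClosedNE X | (F.1 ∩ U).Nonempty} :=
    TopologicalSpace.isOpen_generateFrom_of_mem ⟨U, hU, rfl⟩
  refine Filter.mem_of_superset ((o1.prod o2).mem_nhds ⟨fun h => hcut (h hgL), x, hx, ?_⟩) ?_
  · simpa [U] using hδ
  · rintro q ⟨hq1, y, hyF, hyU⟩
    refine (hp_phi_not_sub hV hJ.subset q).2 ⟨f, hf, y, hyF, fun hmem => hq1 ?_⟩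
    exact fun v hv => hv.2 _ q.1.2.1 (hp_cut_mem hV q.1.2.1 haV hmem hδ hyU)

open Classical in
theorem hp_phi_key {X : Type*} [TopologicalSpace X] [CompactSpace X] [T2Space X]
    {V : Set (H →L[ℂ] K)} (hV : IsIdealT tri V V) {J : Set (H →L[ℂ] K)} (hJ : IsIdealT tri V J)
    {U : Set X} (hU : IsOpen U) :
    @IsOpen _ (TopologicalSpace.induced (hpPhi X hV) inferInstance)
      {p : IdP (tri (H := H) (K := K)) V × ClosedNE X | ¬ J ⊆ p.1.1 ∧ (p.2.1 ∩ U).Nonempty} := by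
  have hid := hp_fib_ideal (X := X) hV _ (hp_fib_ite hJ (hp_zero_ideal hV) U)
  refine ⟨{I | ¬ hpFib X V (fun x => if x ∈ U then J else {0}) ⊆ I.1},
    TopologicalSpace.isOpen_generateFrom_of_mem ⟨_, hid, rfl⟩, ?_⟩
  ext p
  refine (hp_phi_not_sub hV hid.subset p).trans ?_
  constructor
  · rintro ⟨f, hf, x, hx, hfx⟩
    have h1 := hf.2 x
    by_cases hxU : x ∈ U
    · simp only [hxU, if_true] at h1
      exact ⟨fun h => hfx (h h1), x, hx, hxU⟩
    · simp only [hxU, if_false, Set.mem_singleton_iff] at h1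
      exact absurd (h1 ▸ p.1.2.1.zero_mem) hfx
  · rintro ⟨h1, x, hx, hxU⟩
    obtain ⟨v, hv, hvI⟩ := Set.not_subset.1 h1
    obtain ⟨f, f1, f2, f3⟩ := hp_bump hU hxU v
    refine ⟨f, ⟨fun y => ?_, fun y => ?_⟩, x, hx, by rwa [f1]⟩
    · obtain ⟨c, hc⟩ := f3 y
      rw [hc]; exact hV.smul_mem _ _ (hJ.subset hv)
    · by_cases hy : y ∈ U
      · obtain ⟨c, hc⟩ := f3 y
        simp only [hy, if_true]
        rw [hc]; exact hJ.smul_mem _ _ hv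
      · simp [hy, f2 y hy]

theorem hp_phi_inducing {X : Type*} [TopologicalSpace X] [CompactSpace X] [T2Space X]
    {V : Set (H →L[ℂ] K)} (hV : IsIdealT tri V V) : Topology.IsInducing (hpPhi X hV) := by
  refine ⟨le_antisymm (hp_phi_continuous hV).le_induced ?_⟩
  refine le_inf ?_ ?_
  · rw [← continuous_iff_le_induced]
    refine continuous_generateFrom_iff.2 ?_
    rintro _ ⟨J, hJ, rfl⟩
    convert hp_phi_key (X := X) hV hJ isOpen_univ using 1
    ext p
    have : p.2.1.Nonempty := p.2.2.2
    simp [this]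
  · rw [← continuous_iff_le_induced]
    refine continuous_generateFrom_iff.2 ?_
    rintro _ ⟨U, hU, rfl⟩
    convert hp_phi_key (X := X) hV hV hU using 1
    ext p
    have : ¬ V ⊆ p.1.1 := fun h => p.1.2.2 (subset_antisymm p.1.2.1.subset h)
    simp [this]

theorem hp_phi_injective {X : Type*} [TopologicalSpace X] [CompactSpace X] [T2Space X]
    {V : Set (H →L[ℂ] K)} (hV : IsIdealT tri V V) : Function.Injective (hpPhi X hV) := by
  have key : ∀ p q : IdP (tri (H := H) (K := K)) V × ClosedNE X,
      hpPhi X hV p = hpPhi X hV q → p.1.1 ⊆ q.1.1 ∧ q.2.1 ⊆ p.2.1 := by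
    intro p q h
    have h' : ∀ f, f ∈ (hpPhi X hV p).1 → f ∈ (hpPhi X hV q).1 := fun f hf => h ▸ hf
    refine ⟨fun v hv => ?_, fun x hx => ?_⟩
    · obtain ⟨x, hx⟩ := q.2.2.2
      exact (h' (ContinuousMap.const X v) ⟨fun _ => p.1.2.1.subset hv, fun _ _ => hv⟩).2 x hx
    · by_contra hxp
      have : ¬ V ⊆ q.1.1 := fun h => q.1.2.2 (subset_antisymm q.1.2.1.subset h)
      obtain ⟨v, hv, hvI⟩ := Set.not_subset.1 this
      obtain ⟨f, f1, f2, f3⟩ := hp_bump p.2.2.1.isOpen_compl hxp v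
      have hf : f ∈ (hpPhi X hV p).1 := by
        refine ⟨fun y => ?_, fun y hy => ?_⟩
        · obtain ⟨c, hc⟩ := f3 y
          rw [hc]; exact hV.smul_mem _ _ hv
        · rw [f2 y (fun h => h hy)]; exact p.1.2.1.zero_mem
      exact hvI (f1 ▸ (h' f hf).2 x hx)
  intro p q h
  have h1 := key p q h
  have h2 := key q p h.symm
  exact Prod.ext (Subtype.ext (subset_antisymm h1.1 h2.1))
    (Subtype.ext (subset_antisymm h2.2 h1.2))

end Helpers

/-- The map `Φ_X : (I, F) ↦ {f ∈ C(X,V) : f x ∈ I for all x ∈ F}` is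
a homeomorphism (i.e. a topological embedding) from `Id'(V) × F(X)` onto its image in
`Id'(C(X,V))`, where the ideal spaces carry the topology `τ_w` and `F(X)` the lower
Vietoris topology. -/
theorem eval_ideal_map_isEmbedding
    {X : Type*} [TopologicalSpace X] [CompactSpace X] [T2Space X]
    (V : Set (H →L[ℂ] K)) (hV : IsIdealT (tri (H := H) (K := K)) V V) :
    ∃ Φ : IdP (tri (H := H) (K := K)) V × ClosedNE X →
        IdP (ctri (X := X)) (CXV X V),
      (∀ (I : IdP (tri (H := H) (K := K)) V) (F : ClosedNE X),
        (Φ (I, F)).1 = {f : C(X, H →L[ℂ] K) | f ∈ CXV X V ∧ ∀ x ∈ F.1, f x ∈ I.1}) ∧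
      Topology.IsEmbedding Φ := by
  exact ⟨hpPhi X hV, fun _ _ => rfl, hp_phi_inducing hV, hp_phi_injective hV⟩
end
end

section
/- Let V ⊆ B(H_1,K_1) and W ⊆ B(H_2,K_2) be TROs and let φ : V → W be a continuous surjective complex-linear map satisfying φ(x y* z) = φ(x) φ(y)* φ(z) for all x, y, z ∈ V. If P is a primal ideal of W, then φ^{-1}(P) is a primal ideal of V. -/
noncomputable section

open ContinuousLinearMap

variable {H K : Type*} [NormedAddCommGroup H] [InnerProductSpace ℂ H] [CompleteSpace H]
  [NormedAddCommGroup K] [InnerProductSpace ℂ K] [CompleteSpace K]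

theorem continuous_tri3 {X : Type*} [TopologicalSpace X] {f g h : X → (H →L[ℂ] K)}
    (hf : Continuous f) (hg : Continuous g) (hh : Continuous h) :
    Continuous fun x => tri (f x) (g x) (h x) :=
  hf.clm_comp
      (((ContinuousLinearMap.adjoint :
          (H →L[ℂ] K) ≃ₗᵢ⋆[ℂ] (K →L[ℂ] H)).continuous.comp hg).clm_comp hh)

theorem continuous_oddProdT_tri (n : ℕ) :
    Continuous (oddProdT (tri (H := H) (K := K)) n) := by
  induction n with
  | zero => exact continuous_apply _
  | succ n ih =>
    refine continuous_tri3 (ih.comp ?_) (continuous_apply _) (continuous_apply _)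
    exact continuous_pi fun i => continuous_apply _

theorem oddProdT_mem_map {E F : Type*} (t : E → E → E → E) (s : F → F → F → F)
    (V : Set E) (φ : E → F) (hV : ∀ a b c, a ∈ V → b ∈ V → c ∈ V → t a b c ∈ V)
    (htri : ∀ x ∈ V, ∀ y ∈ V, ∀ z ∈ V, φ (t x y z) = s (φ x) (φ y) (φ z)) (n : ℕ) :
    ∀ j : Fin (2 * n + 1) → E, (∀ i, j i ∈ V) →
      oddProdT t n j ∈ V ∧ φ (oddProdT t n j) = oddProdT s n (fun i => φ (j i)) := by
  induction n with
  | zero => intro j hj; exact ⟨hj 0, rfl⟩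
  | succ n ih =>
    intro j hj
    obtain ⟨h1, h2⟩ := ih (fun i => j (Fin.castLE (by omega) i)) (fun i => hj _)
    refine ⟨hV _ _ _ h1 (hj _) (hj _), ?_⟩
    simp only [oddProdT]
    rw [htri _ h1 _ (hj _) _ (hj _), h2]

/-- Let `V ⊆ B(H₁,K₁)` and `W ⊆ B(H₂,K₂)` be TROs and let
`φ : V → W` be a continuous surjective complex-linear map with
`φ (x y* z) = φ x (φ y)* φ z` on `V`. If `P` is a primal ideal of `W`, then
`φ⁻¹(P)` is a primal ideal of `V`. -/
theorem preimage_primal_of_tro_hom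
    {H₁ K₁ H₂ K₂ : Type*}
    [NormedAddCommGroup H₁] [InnerProductSpace ℂ H₁] [CompleteSpace H₁]
    [NormedAddCommGroup K₁] [InnerProductSpace ℂ K₁] [CompleteSpace K₁]
    [NormedAddCommGroup H₂] [InnerProductSpace ℂ H₂] [CompleteSpace H₂]
    [NormedAddCommGroup K₂] [InnerProductSpace ℂ K₂] [CompleteSpace K₂]
    (V : Set (H₁ →L[ℂ] K₁)) (hV : IsIdealT (tri (H := H₁) (K := K₁)) V V)
    (W : Set (H₂ →L[ℂ] K₂)) (hW : IsIdealT (tri (H := H₂) (K := K₂)) W W)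
    (φ : (H₁ →L[ℂ] K₁) → (H₂ →L[ℂ] K₂))
    (hmaps : Set.MapsTo φ V W) (hsurj : Set.SurjOn φ V W)
    (hcont : ContinuousOn φ V)
    (hadd : ∀ a ∈ V, ∀ b ∈ V, φ (a + b) = φ a + φ b)
    (hsmul : ∀ (c : ℂ), ∀ a ∈ V, φ (c • a) = c • φ a)
    (htri : ∀ x ∈ V, ∀ y ∈ V, ∀ z ∈ V, φ (tri x y z) = tri (φ x) (φ y) (φ z))
    (P : Set (H₂ →L[ℂ] K₂)) (hP : IsPrimalT tri W P) :
    IsPrimalT tri V (V ∩ φ ⁻¹' P) := by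
  have h0 : φ 0 = 0 := by
    have := hsmul 0 0 hV.zero_mem
    simpa using this
  refine ⟨?_, ?_⟩
  · have hI := hP.1
    refine ⟨Set.inter_subset_left, hcont.preimage_isClosed_of_isClosed hV.isClosed hI.isClosed,
      ⟨hV.zero_mem, ?_⟩, ?_, ?_, ?_, ?_⟩
    · show φ 0 ∈ P
      rw [h0]; exact hI.zero_mem
    · rintro a b ⟨ha, ha'⟩ ⟨hb, hb'⟩
      refine ⟨hV.add_mem _ _ ha hb, ?_⟩
      show φ _ ∈ P
      rw [hadd a ha b hb]; exact hI.add_mem _ _ ha' hb'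
    · rintro c a ⟨ha, ha'⟩
      refine ⟨hV.smul_mem _ _ ha, ?_⟩
      show φ _ ∈ P
      rw [hsmul c a ha]; exact hI.smul_mem _ _ ha'
    · rintro a b c ⟨ha, ha'⟩ hb hc
      refine ⟨hV.tri_mem_left _ _ _ ha hb hc, ?_⟩
      show φ _ ∈ P
      rw [htri a ha b hb c hc]; exact hI.tri_mem_left _ _ _ ha' (hmaps hb) (hmaps hc)
    · rintro a b c ha hb ⟨hc, hc'⟩
      refine ⟨hV.tri_mem_left _ _ _ ha hb hc, ?_⟩
      show φ _ ∈ P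
      rw [htri a ha b hb c hc]; exact hI.tri_mem_right _ _ _ (hmaps ha) (hmaps hb) hc'
  · intro n hn J hJ hz
    suffices hex : ∃ k, closure (φ '' J k) ⊆ P by
      obtain ⟨k, hk⟩ := hex
      exact ⟨k, fun x hx => ⟨(hJ k).subset hx, hk (subset_closure ⟨x, hx, rfl⟩)⟩⟩
    refine hP.2 n hn (fun i => closure (φ '' J i)) ?_ ?_
    · intro i
      have hi := hJ i
      refine ⟨closure_minimal ?_ hW.isClosed, isClosed_closure, subset_closure ⟨0, hi.zero_mem, h0⟩,
        ?_, ?_, ?_, ?_⟩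
      · rintro _ ⟨x, hx, rfl⟩
        exact hmaps (hi.subset hx)
      · intro a b ha hb
        refine map_mem_closure₂ continuous_add ha hb ?_
        rintro _ ⟨x, hx, rfl⟩ _ ⟨y, hy, rfl⟩
        exact ⟨x + y, hi.add_mem _ _ hx hy, hadd x (hi.subset hx) y (hi.subset hy)⟩
      · intro c a ha
        refine map_mem_closure (continuous_const_smul c) ha ?_
        rintro _ ⟨x, hx, rfl⟩
        exact ⟨c • x, hi.smul_mem _ _ hx, hsmul c x (hi.subset hx)⟩
      · intro a b c ha hb hc
        obtain ⟨b, hbv, rfl⟩ := hsurj hb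
        obtain ⟨c, hcv, rfl⟩ := hsurj hc
        refine map_mem_closure (f := fun a => tri a (φ b) (φ c))
          (continuous_tri3 continuous_id continuous_const continuous_const) ha ?_
        rintro _ ⟨x, hx, rfl⟩
        exact ⟨tri x b c, hi.tri_mem_left _ _ _ hx hbv hcv, htri x (hi.subset hx) b hbv c hcv⟩
      · intro a b c ha hb hc
        obtain ⟨a, hav, rfl⟩ := hsurj ha
        obtain ⟨b, hbv, rfl⟩ := hsurj hb
        refine map_mem_closure (f := fun c => tri (φ a) (φ b) c)
          (continuous_tri3 continuous_const continuous_const continuous_id) hc ?_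
        rintro _ ⟨x, hx, rfl⟩
        exact ⟨tri a b x, hi.tri_mem_right _ _ _ hav hbv hx, htri a hav b hbv x (hi.subset hx)⟩
    · intro j hj
      have hj' : j ∈ closure (Set.pi Set.univ fun i => φ '' J i) := by
        rw [closure_pi_set]; exact fun i _ => hj i
      have hcl : IsClosed {j | oddProdT (tri (H := H₂) (K := K₂)) n j = 0} :=
        isClosed_eq (continuous_oddProdT_tri n) continuous_const
      refine closure_minimal ?_ hcl hj'
      intro l hl
      choose x hx hxl using fun i => hl i (Set.mem_univ i)
      have := (oddProdT_mem_map tri tri V φ (fun a b c => hV.tri_mem_left a b c) htri n x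
        (fun i => (hJ i).subset (hx i))).2
      rw [hz x hx, h0] at this
      have hl' : (fun i => φ (x i)) = l := funext hxl
      rw [hl'] at this
      exact this.symm
end
end
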